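/- Let k be a solid and incremental assignment. Then the homogeneous polynomials p_{X′(B)}, B ∈ 𝔹_k, form a basis of 𝒫_k; in particular dim 𝒫_k = #𝔹_k. -/

import Mathlib

open MvPolynomial

noncomputable section

/-- The linear polynomial `p_x : t ↦ x ⬝ t`. -/
def pLin (n : ℕ) (x : Fin n → ℝ) : MvPolynomial (Fin n) ℝ :=
  ∑ i, MvPolynomial.C (x i) * MvPolynomial.X i

/-- `p_Z = ∏_{x ∈ Z} p_x` for a sub-multiset `Z` of the multiset indexed by `ι`. -/
def pProd (n : ℕ) {ι : Type} (v : ι → Fin n → ℝ) (Z : Finset ι) : MvPolynomial (Fin n) ℝ :=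
  ∏ a ∈ Z, pLin n (v a)

/-- `q_Z = ∏_{x ∈ Z} (p_x - λ_x)`. -/
def qProd (n : ℕ) {ι : Type} (v : ι → Fin n → ℝ) (lam : ι → ℝ) (Z : Finset ι) :
    MvPolynomial (Fin n) ℝ :=
  ∏ a ∈ Z, (pLin n (v a) - MvPolynomial.C (lam a))

/-- The pairing `⟨p,q⟩ = (p(∂)q)(0) = ∑_α α! p_α q_α`. -/
def pairing (n : ℕ) (p q : MvPolynomial (Fin n) ℝ) : ℝ :=
  ∑ α ∈ p.support, p.coeff α * q.coeff α * (α.prod fun _ e => (Nat.factorial e : ℝ))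

/-- `B` is a basis of the multiset: its vectors form a basis of `ℝ^n`. -/
def IsBasisSet (n : ℕ) {ι : Type} (v : ι → Fin n → ℝ) (B : Finset ι) : Prop :=
  LinearIndependent ℝ (fun b : B => v b) ∧ Submodule.span ℝ (v '' ↑B) = ⊤

/-- The ideal `𝒥_{𝔹'}` generated by the `p_Z` over all `Z` meeting every `B ∈ 𝔹'`. -/
def Jideal (n : ℕ) {ι : Type} [DecidableEq ι] (v : ι → Fin n → ℝ) (𝔹' : Set (Finset ι)) :
    Ideal (MvPolynomial (Fin n) ℝ) :=
  Ideal.span {p | ∃ Z : Finset ι, (∀ B ∈ 𝔹', (Z ∩ B).Nonempty) ∧ p = pProd n v Z}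

/-- The kernel space `𝒟_{𝔹'}`. -/
def Dspace (n : ℕ) {ι : Type} [DecidableEq ι] (v : ι → Fin n → ℝ) (𝔹' : Set (Finset ι)) :
    Submodule ℝ (MvPolynomial (Fin n) ℝ) where
  carrier := {f | ∀ g ∈ Jideal n v 𝔹', pairing n g f = 0}
  zero_mem' := by intro g _; simp [pairing]
  add_mem' := by
    intro a b ha hb g hg
    have h : pairing n g (a + b) = pairing n g a + pairing n g b := by
      simp only [pairing, MvPolynomial.coeff_add]
      rw [← Finset.sum_add_distrib]
      exact Finset.sum_congr rfl fun α _ => by ring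
    rw [h, ha g hg, hb g hg, add_zero]
  smul_mem' := by
    intro c f hf g hg
    have h : pairing n g (c • f) = c * pairing n g f := by
      simp only [pairing, MvPolynomial.coeff_smul, smul_eq_mul, Finset.mul_sum]
      exact Finset.sum_congr rfl fun α _ => by ring
    rw [h, hf g hg, mul_zero]

/-- A solid assignment `k : 2^X → ℕ`. -/
def Solid (n : ℕ) {ι : Type} (v : ι → Fin n → ℝ) (k : Finset ι → ℕ) : Prop :=
  ∀ Z Z' : Finset ι,
    Submodule.span ℝ (v '' ↑Z) ≤ Submodule.span ℝ (v '' ↑Z') → k Z ≤ k Z'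

/-- An incremental assignment. -/
def Incremental {ι : Type} [DecidableEq ι] (k : Finset ι → ℕ) : Prop :=
  ∀ (Z : Finset ι) (x : ι), k (insert x Z) ≤ k Z + 1

/-- `m(I) = k(I) + n - #I`. -/
def mVal (n : ℕ) {ι : Type} (k : Finset ι → ℕ) (I : Finset ι) : ℕ := k I + n - I.card

/-- `B ∩ X` for `B ⊆ X ∪ Y`. -/
def leftPart {ι : Type} [Fintype ι] [DecidableEq ι] {M : ℕ} (B : Finset (ι ⊕ Fin M)) :
    Finset ι :=
  Finset.univ.filter fun i => Sum.inl i ∈ B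

/-- `B ∩ Y` for `B ⊆ X ∪ Y`, as a set of indices in `Y`. -/
def rightPart {ι : Type} [Fintype ι] [DecidableEq ι] {M : ℕ} (B : Finset (ι ⊕ Fin M)) :
    Finset (Fin M) :=
  Finset.univ.filter fun j => Sum.inr j ∈ B

/-- `Y_i = {y_1, …, y_i}` as a set of indices. -/
def YFin {M : ℕ} (i : ℕ) : Finset (Fin M) := Finset.univ.filter fun j => (j : ℕ) < i

/-- `X ∪ Y_i` as a subset of the index set of `X ∪ Y`. -/
def XYup (ι : Type) [Fintype ι] [DecidableEq ι] (M : ℕ) (i : ℕ) : Finset (ι ⊕ Fin M) :=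
  Finset.univ.image Sum.inl ∪ (YFin (M := M) i).image Sum.inr

/-- `Y` is in general position in `X ∪ Y`: no `y ∈ Y` lies in the span of fewer than `n`
vectors of `(X ∪ Y) ∖ {y}`. -/
def GeneralPosition (n : ℕ) {ι : Type} [Fintype ι] [DecidableEq ι] {M : ℕ}
    (v : ι → Fin n → ℝ) (y : Fin M → Fin n → ℝ) : Prop :=
  ∀ (j : Fin M) (S : Finset (ι ⊕ Fin M)), Sum.inr j ∉ S → S.card < n →
    y j ∉ Submodule.span ℝ (Sum.elim v y '' ↑S)

/-- `𝔹_k : the bases `B` of `X ∪ Y` with `B ∩ Y ⊆ Y_{m(B ∩ X)}`. -/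
def Bk (n : ℕ) {ι : Type} [Fintype ι] [DecidableEq ι] (v : ι → Fin n → ℝ) {M : ℕ}
    (y : Fin M → Fin n → ℝ) (k : Finset ι → ℕ) : Set (Finset (ι ⊕ Fin M)) :=
  {B | IsBasisSet n (Sum.elim v y) B ∧
    ∀ j : Fin M, Sum.inr j ∈ B → (j : ℕ) < mVal n k (leftPart B)}

/-- The space `𝒫_k = ∑_{Z ⊆ X} p_{X∖Z} Π_{k(Z)}`. -/
def Pspace (n : ℕ) {ι : Type} [Fintype ι] [DecidableEq ι] (v : ι → Fin n → ℝ)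
    (k : Finset ι → ℕ) : Submodule ℝ (MvPolynomial (Fin n) ℝ) :=
  ⨆ Z : Finset ι,
    Submodule.map (LinearMap.mulLeft ℝ (pProd n v (Finset.univ \ Z)))
      (MvPolynomial.restrictTotalDegree (Fin n) ℝ (k Z))

/-- The constants `λ` are generic: each basis `B` determines a point `bp B` at which
`q_z` vanishes exactly when `z ∈ B`. -/
def Generic (n : ℕ) {ι : Type} (v : ι → Fin n → ℝ) (lam : ι → ℝ)
    (bp : Finset ι → Fin n → ℝ) : Prop :=
  ∀ B : Finset ι, IsBasisSet n v B →
    ∀ z : ι, MvPolynomial.eval (bp B) (pLin n (v z) - MvPolynomial.C (lam z)) = 0 ↔ z ∈ B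

/-- `x` is placable in `𝔹'`. -/
def Placable {ι : Type} [DecidableEq ι] (x : ι) (𝔹' : Set (Finset ι)) : Prop :=
  ∀ B ∈ 𝔹', ∃ a ∈ B, (insert x B).erase a ∈ 𝔹'

/-- `𝔹'` is placible. -/
inductive Placible {ι : Type} [DecidableEq ι] : Set (Finset ι) → Prop
  | singleton (B : Finset ι) : Placible {B}
  | split (𝔹' : Set (Finset ι)) (x : ι) (hx : Placable x 𝔹')
      (hne1 : {B ∈ 𝔹' | x ∈ B}.Nonempty) (hne2 : {B ∈ 𝔹' | x ∉ B}.Nonempty)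
      (hp1 : Placible {B ∈ 𝔹' | x ∈ B}) (hp2 : Placible {B ∈ 𝔹' | x ∉ B}) :
      Placible 𝔹'

/-- `X(I)` : the elements of `X ∖ I` not in the span of the earlier elements of `I`. -/
def XsetI (n : ℕ) {ι : Type} [Fintype ι] [DecidableEq ι] [LinearOrder ι]
    (v : ι → Fin n → ℝ) (I : Finset ι) : Finset ι := by
  classical
  exact Finset.univ.filter fun x =>
    x ∉ I ∧ v x ∉ Submodule.span ℝ (v '' {b | b ∈ I ∧ b < x})

/-- `X'(B)` for `B ⊆ X ∪ Y`, with the order on `X ∪ Y` putting `X` (with its own order)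
before `Y` (ordered as given). -/
def XprimeB (n : ℕ) {ι : Type} [Fintype ι] [DecidableEq ι] [LinearOrder ι] {M : ℕ}
    (v : ι → Fin n → ℝ) (y : Fin M → Fin n → ℝ) (B : Finset (ι ⊕ Fin M)) :
    Finset (ι ⊕ Fin M) := by
  classical
  exact Finset.univ.filter fun z =>
    z ∉ B ∧ Sum.elim v y z ∉ Submodule.span ℝ
      (Sum.elim v y '' {b | b ∈ B ∧ Sum.Lex (· < ·) (· < ·) b z})

/-- The least space `Π(Θ)`. -/
def leastSpace (n : ℕ) (Θ : Finset (Fin n → ℝ)) : Submodule ℝ (MvPolynomial (Fin n) ℝ) :=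
  Submodule.span ℝ
    {f | ∃ (c : (Fin n → ℝ) → ℝ) (J : ℕ),
      f = (Nat.factorial J : ℝ)⁻¹ • ∑ θ ∈ Θ, c θ • pLin n θ ^ J ∧ f ≠ 0 ∧
      ∀ j < J, ∑ θ ∈ Θ, c θ • pLin n θ ^ j = 0}

/-- The central space `𝒫(X)`, spanned by the `p_Z` over short `Z`. -/
def centralP (n : ℕ) {ι : Type} [Fintype ι] [DecidableEq ι] (v : ι → Fin n → ℝ) :
    Submodule ℝ (MvPolynomial (Fin n) ℝ) :=
  Submodule.span ℝ
    {p | ∃ Z : Finset ι, Submodule.span ℝ (v '' ↑(Finset.univ \ Z)) = ⊤ ∧ p = pProd n v Z}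

end

section helpers

lemma aux_pLin_add (n : ℕ) (a b : Fin n → ℝ) : pLin n (a + b) = pLin n a + pLin n b := by
  simp [pLin, add_mul, Finset.sum_add_distrib]

lemma aux_pLin_smul (n : ℕ) (c : ℝ) (a : Fin n → ℝ) : pLin n (c • a) = c • pLin n a := by
  simp [pLin, Finset.smul_sum, MvPolynomial.smul_eq_C_mul, mul_assoc]

lemma aux_pLin_zero (n : ℕ) : pLin n 0 = 0 := by
  simp [pLin]

lemma aux_pLin_single (n : ℕ) (i : Fin n) : pLin n (Pi.single i 1) = MvPolynomial.X i := by
  rw [pLin, Finset.sum_eq_single i]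
  · simp
  · intro b _ hb
    simp [hb]
  · simp

lemma aux_pLin_deg (n : ℕ) (a : Fin n → ℝ) : (pLin n a).totalDegree ≤ 1 := by
  refine MvPolynomial.totalDegree_finsetSum_le ?_
  intro i _
  refine (MvPolynomial.totalDegree_mul _ _).trans ?_
  simp

lemma aux_eval_pLin (n : ℕ) (a t : Fin n → ℝ) :
    MvPolynomial.eval t (pLin n a) = ∑ i, a i * t i := by
  simp [pLin]

lemma aux_pProd_deg (n : ℕ) {ι : Type} (v : ι → Fin n → ℝ) (Z : Finset ι) :
    (pProd n v Z).totalDegree ≤ Z.card := by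
  refine (MvPolynomial.totalDegree_finsetProd _ _).trans ?_
  refine (Finset.sum_le_sum fun i _ => aux_pLin_deg n (v i)).trans ?_
  simp

lemma aux_sep (n : ℕ) {κ : Type} (w : κ → Fin n → ℝ) (J : Set κ) (a : Fin n → ℝ)
    (ha : a ∉ Submodule.span ℝ (w '' J)) :
    ∃ t : Fin n → ℝ, (∀ j ∈ J, ∑ i, w j i * t i = 0) ∧ ∑ i, a i * t i ≠ 0 := by
  obtain ⟨f, hf, hle⟩ := Submodule.exists_le_ker_of_notMem ha
  refine ⟨fun i => f fun j => if i = j then 1 else 0, ?_, ?_⟩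
  · intro j hj
    have : f (w j) = 0 := hle (Submodule.subset_span ⟨j, hj, rfl⟩)
    rw [LinearMap.pi_apply_eq_sum_univ] at this
    simpa using this
  · rw [LinearMap.pi_apply_eq_sum_univ] at hf
    simpa using hf

/-- Division by a linear form on a subspace. -/
lemma aux_div (n : ℕ) {κ : Type} (w : κ → Fin n → ℝ) (J : Set κ) (a : Fin n → ℝ)
    (ha : a ∉ Submodule.span ℝ (w '' J)) (f : MvPolynomial (Fin n) ℝ)
    (hf : ∀ t : Fin n → ℝ, (∀ j ∈ J, ∑ i, w j i * t i = 0) →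
      (∑ i, a i * t i) * MvPolynomial.eval t f = 0)
    (t : Fin n → ℝ) (ht : ∀ j ∈ J, ∑ i, w j i * t i = 0) : MvPolynomial.eval t f = 0 := by
  obtain ⟨t0, h0, h1⟩ := aux_sep n w J a ha
  by_cases hat : ∑ i, a i * t i = 0
  · have key : ∀ s : ℝ, s ≠ 0 → MvPolynomial.eval (t + s • t0) f = 0 := by
      intro s hs
      have h2 := hf (t + s • t0) (by
        intro j hj
        have e : ∑ i, w j i * (t + s • t0) i
            = ∑ i, w j i * t i + s * ∑ i, w j i * t0 i := by
          rw [Finset.mul_sum, ← Finset.sum_add_distrib]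
          exact Finset.sum_congr rfl fun i _ => by simp; ring
        rw [e, ht j hj, h0 j hj]; simp)
      have e : ∑ i, a i * (t + s • t0) i
            = ∑ i, a i * t i + s * ∑ i, a i * t0 i := by
          rw [Finset.mul_sum, ← Finset.sum_add_distrib]
          exact Finset.sum_congr rfl fun i _ => by simp; ring
      rw [e, hat, zero_add] at h2
      rcases mul_eq_zero.1 h2 with h3 | h3
      · exact absurd h3 (mul_ne_zero hs h1)
      · exact h3
    have hc : Continuous fun s : ℝ => MvPolynomial.eval (t + s • t0) f := by
      have := MvPolynomial.continuous_eval f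
      exact this.comp (by fun_prop)
    have hd : Dense {s : ℝ | s ≠ 0} := dense_compl_singleton 0
    have := hc.ext_on hd (continuous_const (y := (0:ℝ))) (fun s hs => key s hs)
    have h4 := congrFun this 0
    simpa using h4
  · rcases mul_eq_zero.1 (hf t ht) with h3 | h3
    · exact absurd h3 hat
    · exact h3

lemma aux_indep (n : ℕ) {κ : Type} [LinearOrder κ] (w : κ → Fin n → ℝ)
    (G : Finset κ → Finset κ)
    (hG : ∀ B z, z ∈ G B ↔ z ∉ B ∧ w z ∉ Submodule.span ℝ (w '' {b | b ∈ B ∧ b < z}))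
    {β : Type} (Bf : β → Finset κ) (hinj : Function.Injective Bf)
    (hind : ∀ b, LinearIndepOn ℝ w (Bf b : Set κ)) (c : β → ℝ) (S : Finset κ) :
    (∀ a ∈ S, ∀ b, a < b → b ∈ S) → ∀ (J : Finset κ) (s : Finset β),
      (∀ b ∈ s, ∀ z, z ∉ S → (z ∈ Bf b ↔ z ∈ J)) → (∀ z ∈ J, z ∉ S) →
      (∀ t : Fin n → ℝ, (∀ j ∈ (J : Set κ), ∑ i, w j i * t i = 0) →
        MvPolynomial.eval t (∑ b ∈ s, c b • pProd n w (G (Bf b) ∩ S)) = 0) →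
      ∀ b ∈ s, c b = 0 := by
  classical
  induction S using Finset.induction_on_min with
  | empty =>
    intro _ J s hs _ hrel b hb
    have hs1 : s = {b} := by
      ext b'
      simp only [Finset.mem_singleton]
      constructor
      · intro hb'
        apply hinj
        ext z
        rw [hs b hb z (by simp), hs b' hb' z (by simp)]
      · rintro rfl; exact hb
    have := hrel 0 (by simp)
    rw [hs1] at this
    simpa [pProd] using this
  | insert a S' hmin ih =>
    intro hup J s hs hJ hrel
    have haS' : a ∉ S' := fun h => lt_irrefl _ (hmin a h)
    have hup' : ∀ x ∈ S', ∀ b, x < b → b ∈ S' := by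
      intro x hx b hb
      have := hup x (Finset.mem_insert_of_mem hx) b hb
      rcases Finset.mem_insert.1 this with h | h
      · subst h; exact absurd (hmin x hx) (not_lt_of_gt hb)
      · exact h
    have hlt : ∀ b, b < a ↔ b ∉ insert a S' := by
      intro b
      constructor
      · intro hb hb'
        rcases Finset.mem_insert.1 hb' with h | h
        · subst h; exact lt_irrefl _ hb
        · exact lt_asymm hb (hmin b h)
      · intro hb
        rcases lt_trichotomy b a with h | h | h
        · exact h
        · subst h; simp at hb
        · exact absurd (hup a (by simp) b h) hb
    have hpre : ∀ b ∈ s, {x | x ∈ Bf b ∧ x < a} = (J : Set κ) := by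
      intro b hb
      ext x
      simp only [Set.mem_ofPred_eq, Finset.mem_coe]
      constructor
      · rintro ⟨h1, h2⟩
        exact (hs b hb x ((hlt x).1 h2)).1 h1
      · intro h1
        exact ⟨(hs b hb x (hJ x h1)).2 h1, (hlt x).2 (hJ x h1)⟩
    have haJ : a ∉ J := fun h => hJ a h (by simp)
    have hcap1 : ∀ B, a ∉ G B → G B ∩ insert a S' = G B ∩ S' := by
      intro B h
      rw [Finset.inter_insert_of_notMem h]
    have hcap2 : ∀ B, a ∈ G B → pProd n w (G B ∩ insert a S')
        = pLin n (w a) * pProd n w (G B ∩ S') := by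
      intro B h
      rw [Finset.inter_insert_of_mem h, pProd, Finset.prod_insert (by simp [haS'])]
      rfl
    by_cases hspan : w a ∈ Submodule.span ℝ (w '' (J : Set κ))
    · have hnot : ∀ b ∈ s, a ∉ Bf b := by
        intro b hb hab
        refine (hind b).notMem_span (Finset.mem_coe.2 hab) ?_
        refine Submodule.span_mono (Set.image_mono ?_) hspan
        intro x hx
        refine ⟨(hs b hb x (hJ x hx)).2 hx, ?_⟩
        rintro rfl
        exact haJ hx
      refine ih hup' J s ?_ (fun z hz h => hJ z hz (Finset.mem_insert_of_mem h)) ?_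
      · intro b hb z hz
        by_cases hza : z = a
        · subst hza
          simp [haJ, hnot b hb]
        · exact hs b hb z (by simp [hza, hz])
      · intro t ht
        rw [← hrel t ht]
        congr 1
        refine Finset.sum_congr rfl fun b hb => ?_
        rw [hcap1]
        rw [hG, hpre b hb]
        tauto
    · have hs1 : ∀ b ∈ s.filter (fun b => a ∈ Bf b), c b = 0 := by
        refine ih hup' (insert a J) _ ?_ ?_ ?_
        · intro b hb z hz
          rw [Finset.mem_filter] at hb
          by_cases hza : z = a
          · subst hza
            simp [hb.2]
          · rw [hs b hb.1 z (by simp [hza, hz])]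
            simp [hza]
        · intro z hz h
          rcases Finset.mem_insert.1 hz with h1 | h1
          · subst h1; exact haS' h
          · exact hJ z h1 (Finset.mem_insert_of_mem h)
        · intro t ht
          rw [← hrel t (fun j hj => ht j (by simp at hj; simp [hj])), map_sum, map_sum,
            Finset.sum_filter]
          refine Finset.sum_congr rfl fun b hb => ?_
          split_ifs with hab
          · rw [hcap1]
            rw [hG]
            tauto
          · rw [hcap2]
            · rw [MvPolynomial.smul_eval, map_mul, aux_eval_pLin, ht a (by simp)]
              simp
            · rw [hG, hpre b hb]
              tauto
      have hs0 : ∀ b ∈ s.filter (fun b => a ∉ Bf b), c b = 0 := by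
        refine ih hup' J _ ?_ (fun z hz h => hJ z hz (Finset.mem_insert_of_mem h)) ?_
        · intro b hb z hz
          rw [Finset.mem_filter] at hb
          by_cases hza : z = a
          · subst hza
            simp [hb.2, haJ]
          · rw [hs b hb.1 z (by simp [hza, hz])]
        · refine aux_div n w J (w a) hspan _ ?_
          intro t ht
          rw [← hrel t ht, ← aux_eval_pLin, ← map_mul]
          congr 1
          rw [Finset.mul_sum, Finset.sum_filter]
          refine Finset.sum_congr rfl fun b hb => ?_
          split_ifs with hab
          · rw [hs1 b (by simp [hb, hab])]
            simp
          · rw [hcap2]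
            · rw [mul_smul_comm]
            · rw [hG, hpre b hb]
              tauto
      intro b hb
      by_cases hab : a ∈ Bf b
      · exact hs1 b (by simp [hb, hab])
      · exact hs0 b (by simp [hb, hab])

lemma aux_span_mem {V : Type} [AddCommGroup V] [Module ℝ V] {s : Set V} {C : Submodule ℝ V}
    (f : V →ₗ[ℝ] V) (h : ∀ g ∈ s, f g ∈ C) : ∀ p ∈ Submodule.span ℝ s, f p ∈ C := by
  have : Submodule.span ℝ s ≤ C.comap f := Submodule.span_le.2 h
  exact this

lemma aux_sup_mem {V : Type} [AddCommGroup V] [Module ℝ V] {A B C : Submodule ℝ V}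
    (f : V →ₗ[ℝ] V) (hA : ∀ p ∈ A, f p ∈ C) (hB : ∀ p ∈ B, f p ∈ C) :
    ∀ p ∈ A ⊔ B, f p ∈ C := by
  have : A ⊔ B ≤ C.comap f := sup_le hA hB
  exact this

lemma aux_mem_Xprime (n : ℕ) {ι : Type} [Fintype ι] [LinearOrder ι] {M : ℕ}
    (v : ι → Fin n → ℝ) (y : Fin M → Fin n → ℝ) (B : Finset (ι ⊕ Fin M)) (z : ι ⊕ Fin M) :
    z ∈ XprimeB n v y B ↔ z ∉ B ∧ Sum.elim v y z ∉ Submodule.span ℝ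
      (Sum.elim v y '' {b | b ∈ B ∧ Sum.Lex (· < ·) (· < ·) b z}) := by
  simp only [XprimeB, Finset.mem_filter, Finset.mem_univ, true_and]

/-- the target spaces of the spanning induction -/
noncomputable def auxT (n : ℕ) {ι : Type} [Fintype ι] [LinearOrder ι] {M : ℕ}
    (v : ι → Fin n → ℝ) (y : Fin M → Fin n → ℝ) (k : Finset ι → ℕ)
    (S J : Finset (ι ⊕ Fin M)) : Submodule ℝ (MvPolynomial (Fin n) ℝ) :=
  Submodule.span ℝ {p | ∃ B ∈ Bk n v y k, B \ S = J ∧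
    p = pProd n (Sum.elim v y) (XprimeB n v y B ∩ S)}

section steps
variable (n : ℕ) {ι : Type} [Fintype ι] [LinearOrder ι] {M : ℕ}
    (v : ι → Fin n → ℝ) (y : Fin M → Fin n → ℝ) (k : Finset ι → ℕ)

lemma aux_step1 (S S' J : Finset (ι ⊕ Fin M)) (a : ι ⊕ Fin M) (hS : S = insert a S')
    (haJ : a ∉ J) : ∀ p ∈ auxT n v y k S' (insert a J), p ∈ auxT n v y k S J := by
  subst hS
  refine aux_span_mem LinearMap.id ?_
  rintro p ⟨B, hB, hJ, rfl⟩
  refine Submodule.subset_span ⟨B, hB, ?_, ?_⟩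
  · ext z
    have := Finset.ext_iff.1 hJ z
    simp only [Finset.mem_sdiff, Finset.mem_insert] at this ⊢
    by_cases hz : z = a
    · subst hz; simp [haJ]
    · simpa [hz] using this
  · have : a ∉ XprimeB n v y B := by
      rw [aux_mem_Xprime]
      have : a ∈ B \ S' := by rw [hJ]; simp
      have := (Finset.mem_sdiff.1 this).1
      tauto
    rw [Finset.inter_insert_of_notMem this]
    rfl

lemma aux_pre (B S' J : Finset (ι ⊕ Fin M)) (a : ι ⊕ Fin M)
    (hlt : ∀ b, Sum.Lex (· < ·) (· < ·) b a ↔ b ∉ insert a S')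
    (haJ : a ∉ J) (hJ : B \ S' = J) :
    {b | b ∈ B ∧ Sum.Lex (· < ·) (· < ·) b a} = (J : Set (ι ⊕ Fin M)) := by
  ext b
  have := Finset.ext_iff.1 hJ b
  simp only [Set.mem_ofPred_eq, hlt, Finset.mem_coe, Finset.mem_insert, Finset.mem_sdiff] at this ⊢
  by_cases hb : b = a
  · subst hb; simp [haJ]
  · simp [hb, this]

lemma aux_sd (B S' J : Finset (ι ⊕ Fin M)) (a : ι ⊕ Fin M)
    (haJ : a ∉ J) (hJ : B \ S' = J) : B \ insert a S' = J := by
  ext b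
  have := Finset.ext_iff.1 hJ b
  simp only [Finset.mem_insert, Finset.mem_sdiff] at this ⊢
  by_cases hb : b = a
  · subst hb; simp [haJ]
  · simp [hb, this]

lemma aux_step2 (S S' J : Finset (ι ⊕ Fin M)) (a : ι ⊕ Fin M) (hS : S = insert a S')
    (haS : a ∉ S')
    (hlt : ∀ b, Sum.Lex (· < ·) (· < ·) b a ↔ b ∉ S)
    (haJ : a ∉ J) (hsp : Sum.elim v y a ∉ Submodule.span ℝ (Sum.elim v y '' (J : Set (ι ⊕ Fin M)))) :
    ∀ p ∈ auxT n v y k S' J, pLin n (Sum.elim v y a) * p ∈ auxT n v y k S J := by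
  subst hS
  refine aux_span_mem (LinearMap.mulLeft ℝ (pLin n (Sum.elim v y a))) ?_
  rintro p ⟨B, hB, hJ, rfl⟩
  refine Submodule.subset_span ⟨B, hB, aux_sd _ _ _ _ haJ hJ, ?_⟩
  have : a ∈ XprimeB n v y B := by
    rw [aux_mem_Xprime, aux_pre B S' J a hlt haJ hJ]
    refine ⟨fun h => haJ ?_, hsp⟩
    rw [← hJ]; simp [h, haS]
  rw [Finset.inter_insert_of_mem this]
  conv_rhs => rw [pProd, Finset.prod_insert (by simp [haS])]
  rfl

lemma aux_step3 (S S' J : Finset (ι ⊕ Fin M)) (a : ι ⊕ Fin M) (hS : S = insert a S')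
    (hlt : ∀ b, Sum.Lex (· < ·) (· < ·) b a ↔ b ∉ S)
    (haJ : a ∉ J) (hsp : Sum.elim v y a ∈ Submodule.span ℝ (Sum.elim v y '' (J : Set (ι ⊕ Fin M)))) :
    ∀ p ∈ auxT n v y k S' J, p ∈ auxT n v y k S J := by
  subst hS
  refine aux_span_mem LinearMap.id ?_
  rintro p ⟨B, hB, hJ, rfl⟩
  refine Submodule.subset_span ⟨B, hB, aux_sd _ _ _ _ haJ hJ, ?_⟩
  have : a ∉ XprimeB n v y B := by
    rw [aux_mem_Xprime, aux_pre B S' J a hlt haJ hJ]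
    tauto
  rw [Finset.inter_insert_of_notMem this]
  rfl

/-- error space for the `Y` stage -/
noncomputable def auxEY (I : Finset ι) (J : Finset (Fin M)) (d : ℕ) : Submodule ℝ (MvPolynomial (Fin n) ℝ) :=
  Submodule.span ℝ {p | ∃ u q, u ∈ Submodule.span ℝ
    (Sum.elim v y '' (I.disjSum J : Set (ι ⊕ Fin M))) ∧ q.totalDegree < d ∧ p = pLin n u * q}

lemma aux_const_split (C : Submodule ℝ (MvPolynomial (Fin n) ℝ)) (d : ℕ) (h1 : 1 ∈ C)
    (h2 : ∀ (i : Fin n) (q : MvPolynomial (Fin n) ℝ), q.totalDegree < d →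
      MvPolynomial.X i * q ∈ C) (q : MvPolynomial (Fin n) ℝ) (hq : q.totalDegree ≤ d) : q ∈ C := by
  rw [q.as_sum]
  refine Submodule.sum_mem _ fun s hs => ?_
  have hsd := (MvPolynomial.le_totalDegree hs).trans hq
  by_cases h0 : s = 0
  · subst h0
    have : MvPolynomial.monomial 0 (MvPolynomial.coeff 0 q) =
        (MvPolynomial.coeff 0 q) • (1 : MvPolynomial (Fin n) ℝ) := by
      rw [MvPolynomial.smul_eq_C_mul, mul_one]; rfl
    rw [this]
    exact C.smul_mem _ h1
  · obtain ⟨i, hi⟩ := Finsupp.support_nonempty_iff.2 h0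
    have hle : Finsupp.single i 1 ≤ s := by
      rw [Finsupp.single_le_iff]
      have := Finsupp.mem_support_iff.1 hi
      omega
    have e : MvPolynomial.monomial s (MvPolynomial.coeff s q) =
        MvPolynomial.X i * MvPolynomial.monomial (s - Finsupp.single i 1) (MvPolynomial.coeff s q) := by
      rw [MvPolynomial.X, MvPolynomial.monomial_mul, add_tsub_cancel_of_le hle, one_mul]
    rw [e]
    refine h2 i _ ?_
    rw [MvPolynomial.totalDegree_monomial _ (MvPolynomial.mem_support_iff.1 hs)]
    have hdeg : (s.sum fun _ e => e) = 1 + ((s - Finsupp.single i 1).sum fun _ e => e) := by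
      conv_lhs => rw [← add_tsub_cancel_of_le hle]
      rw [Finsupp.sum_add_index' (by simp) (by simp)]
      simp
    omega

lemma aux_leftPart (I : Finset ι) (J : Finset (Fin M)) : leftPart (I.disjSum J) = I := by
  ext i; simp [leftPart]

lemma aux_stageY (hgen : GeneralPosition n v y) (I : Finset ι) (hIM : mVal n k I ≤ M) (ρ : ℕ) :
    ∀ (d e j : ℕ) (J : Finset (Fin M)), d + e = ρ → j + d + e = mVal n k I →
      I.card + J.card + e = n → (∀ i ∈ J, (i : ℕ) < j) →
      LinearIndepOn ℝ (Sum.elim v y) (I.disjSum J : Set (ι ⊕ Fin M)) →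
      ∀ q : MvPolynomial (Fin n) ℝ, q.totalDegree ≤ d →
        q ∈ auxT n v y k ((∅ : Finset ι).disjSum (Finset.univ.filter fun i : Fin M => j ≤ (i : ℕ)))
          (I.disjSum J) ⊔ auxEY n v y I J d := by
  induction ρ using Nat.strong_induction_on with
  | _ ρ ih =>
  intro d e j J hρ hm hcard hJ hli q hq
  rcases e with _ | e
  · have hcard' : (I.disjSum J).card = n := by
      rw [Finset.card_disjSum]; omega
    have htop : Submodule.span ℝ (Sum.elim v y '' (I.disjSum J : Set (ι ⊕ Fin M))) = ⊤ := by
      have := LinearIndependent.span_eq_top_of_card_eq_finrank' hli (by simp [hcard'])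
      rw [Set.image_eq_range]
      exact this
    refine aux_const_split n _ d ?_ ?_ q hq
    · refine Submodule.mem_sup_left (Submodule.subset_span ⟨I.disjSum J, ⟨⟨hli, htop⟩, ?_⟩, ?_, ?_⟩)
      · intro i hi
        rw [aux_leftPart]
        have := hJ i (by simpa using hi)
        omega
      · ext z
        rcases z with z | z
        · simp
        · simp only [Finset.mem_sdiff, Finset.inr_mem_disjSum, Finset.mem_filter, Finset.mem_univ,
            true_and]
          constructor
          · exact fun h => h.1
          · intro h
            have := hJ z h
            exact ⟨h, by omega⟩
      · have : XprimeB n v y (I.disjSum J) ∩ ((∅ : Finset ι).disjSum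
            (Finset.univ.filter fun i : Fin M => j ≤ (i : ℕ))) = ∅ := by
          rw [Finset.eq_empty_iff_forall_notMem]
          intro z hz
          rw [Finset.mem_inter, aux_mem_Xprime] at hz
          obtain ⟨⟨h1, h2⟩, h3⟩ := hz
          rcases z with z | z
          · simp at h3
          · apply h2
            have : {b | b ∈ I.disjSum J ∧ Sum.Lex (· < ·) (· < ·) b (Sum.inr z)} =
                (I.disjSum J : Set (ι ⊕ Fin M)) := by
              ext b
              simp only [Set.mem_ofPred_eq, Finset.mem_coe, and_iff_left_iff_imp]
              intro hb
              rcases b with b | b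
              · simp
              · rw [Sum.lex_inr_inr, Fin.lt_def]
                have h4 := hJ b (by simpa using hb)
                simp at h3
                omega
            rw [this, htop]
            trivial
        rw [this]; simp [pProd]
    · intro i q' hq'
      refine Submodule.mem_sup_right (Submodule.subset_span ⟨Pi.single i 1, q', ?_, hq', ?_⟩)
      · rw [htop]; trivial
      · rw [aux_pLin_single]
  · have hjM : j < M := by omega
    obtain ⟨a, ha⟩ : ∃ a : Fin M, (a : ℕ) = j := ⟨⟨j, hjM⟩, rfl⟩
    have haJ : a ∉ J := fun h => by
      have := hJ a h
      omega
    have haIJ : (Sum.inr a : ι ⊕ Fin M) ∉ I.disjSum J := by simpa using haJ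
    have hsp : Sum.elim v y (Sum.inr a) ∉
        Submodule.span ℝ (Sum.elim v y '' (I.disjSum J : Set (ι ⊕ Fin M))) :=
      hgen a _ haIJ (by rw [Finset.card_disjSum]; omega)
    have hins : I.disjSum (insert a J) = insert (Sum.inr a) (I.disjSum J) := by
      ext z; rcases z with z | z <;> simp
    set S := (∅ : Finset ι).disjSum (Finset.univ.filter fun i : Fin M => j ≤ (i : ℕ)) with hSdef
    set S' := (∅ : Finset ι).disjSum (Finset.univ.filter fun i : Fin M => j + 1 ≤ (i : ℕ)) with hS'def
    have hSS : S = insert (Sum.inr a) S' := by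
      ext z; rcases z with z | z
      · simp [hSdef, hS'def]
      · simp only [hSdef, hS'def, Fin.ext_iff, Finset.mem_insert, Finset.inr_mem_disjSum,
          Finset.mem_filter, Finset.mem_univ, true_and, Sum.inr.injEq]
        omega
    have haS' : (Sum.inr a : ι ⊕ Fin M) ∉ S' := by simp [hS'def, ha]
    have hlt : ∀ b : ι ⊕ Fin M, Sum.Lex (· < ·) (· < ·) b (Sum.inr a) ↔ b ∉ S := by
      intro b
      rcases b with b | b
      · simp [hSdef]
      · rw [Sum.lex_inr_inr, Fin.lt_def]
        simp only [hSdef, Finset.inr_mem_disjSum, Finset.mem_filter, Finset.mem_univ, true_and]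
        omega
    have hJ' : ∀ i ∈ J, (i : ℕ) < j + 1 := fun i hi => (hJ i hi).trans (Nat.lt_succ_self _)
    have h1 := ih (d + e) (by omega) d e (j + 1) (insert a J) rfl (by omega)
      (by rw [Finset.card_insert_of_notMem haJ]; omega)
      (by
        intro i hi
        rcases Finset.mem_insert.1 hi with h | h
        · subst h; simp [ha]
        · exact hJ' i h)
      (by
        rw [hins, Finset.coe_insert]
        exact hli.insert hsp) q hq
    revert h1
    refine aux_sup_mem LinearMap.id ?_ ?_ q
    · intro p hp
      rw [hins] at hp
      exact Submodule.mem_sup_left (aux_step1 n v y k S S' _ _ hSS haIJ p hp)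
    · refine aux_span_mem LinearMap.id ?_
      rintro p ⟨u, q', hu, hq', rfl⟩
      rw [hins, Finset.coe_insert, Set.image_insert_eq, Submodule.mem_span_insert] at hu
      obtain ⟨c, u', hu', rfl⟩ := hu
      rw [aux_pLin_add, aux_pLin_smul, add_mul, smul_mul_assoc]
      refine Submodule.add_mem _ (Submodule.smul_mem _ _ ?_) ?_
      · have h2 := ih (d - 1 + (e + 1)) (by omega) (d - 1) (e + 1) (j + 1) J rfl (by omega)
          (by omega) hJ' hli q' (by omega)
        revert h2
        refine aux_sup_mem (LinearMap.mulLeft ℝ (pLin n (Sum.elim v y (Sum.inr a)))) ?_ ?_ q'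
        · intro p hp
          exact Submodule.mem_sup_left (aux_step2 n v y k S S' _ _ hSS haS' hlt haIJ hsp p hp)
        · refine aux_span_mem _ ?_
          rintro p ⟨u, q'', hu, hq'', rfl⟩
          refine Submodule.mem_sup_right (Submodule.subset_span
            ⟨u, pLin n (Sum.elim v y (Sum.inr a)) * q'', hu, ?_, ?_⟩)
          · have h3 := MvPolynomial.totalDegree_mul (pLin n (Sum.elim v y (Sum.inr a))) q''
            have h4 := aux_pLin_deg n (Sum.elim v y (Sum.inr a))
            omega
          · simp only [LinearMap.mulLeft_apply]
            ring
      · exact Submodule.mem_sup_right (Submodule.subset_span ⟨u', q', hu', hq', rfl⟩)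

/-- error space for the `X` stage -/
noncomputable def auxEX (U I : Finset ι) : Submodule ℝ (MvPolynomial (Fin n) ℝ) :=
  Submodule.span ℝ {p | ∃ u Z q, u ∈ Submodule.span ℝ (v '' (I : Set ι)) ∧ Z ⊆ U ∧
    (q.totalDegree < k (Z ∪ I) ∨
      (u ∈ Submodule.span ℝ (v '' (Z : Set ι)) ∧ q.totalDegree ≤ k (Z ∪ I))) ∧
    p = pLin n u * (pProd n v (U \ Z) * q)}

lemma aux_coe_inl (I : Finset ι) :
    ((I.disjSum (∅ : Finset (Fin M)) : Finset (ι ⊕ Fin M)) : Set (ι ⊕ Fin M))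
      = Sum.inl '' (I : Set ι) := by
  ext z; rcases z with z | z <;> simp

lemma aux_img_inl (I : Finset ι) :
    Sum.elim v y '' ((I.disjSum (∅ : Finset (Fin M)) : Finset (ι ⊕ Fin M)) : Set (ι ⊕ Fin M))
      = v '' (I : Set ι) := by
  rw [aux_coe_inl, ← Set.image_comp]
  rfl

lemma aux_stageX (hgen : GeneralPosition n v y) (hsolid : Solid n v k)
    (hM : ∀ I : Finset ι, (LinearIndependent ℝ fun i : I => v i) → mVal n k I ≤ M)
    (hinc : Incremental k) (U : Finset ι) :
    (∀ a ∈ U, ∀ b, a < b → b ∈ U) → ∀ I : Finset ι, (∀ i ∈ I, i ∉ U) →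
      LinearIndepOn ℝ v (I : Set ι) → ∀ Z ⊆ U, ∀ q : MvPolynomial (Fin n) ℝ,
      q.totalDegree ≤ k (Z ∪ I) →
      pProd n v (U \ Z) * q ∈ auxT n v y k (U.disjSum (Finset.univ : Finset (Fin M)))
        (I.disjSum ∅) ⊔ auxEX n v k U I := by
  have hmono : ∀ Z Z' : Finset ι, Z ⊆ Z' → k Z ≤ k Z' := fun Z Z' h =>
    hsolid Z Z' (Submodule.span_mono (Set.image_mono (Finset.coe_subset.2 h)))
  have habs : ∀ (Z : Finset ι) (x : ι), v x ∈ Submodule.span ℝ (v '' (Z : Set ι)) →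
      k (insert x Z) ≤ k Z := by
    intro Z x hx
    refine hsolid _ _ (Submodule.span_le.2 ?_)
    rw [Finset.coe_insert, Set.image_insert_eq]
    exact Set.insert_subset hx Submodule.subset_span
  induction U using Finset.induction_on_min with
  | empty =>
    intro _ I _ hI Z hZ q hq
    obtain rfl := Finset.subset_empty.1 hZ
    have hIn : I.card ≤ n := by
      have := hI.fintype_card_le_finrank
      simpa using this
    have hli : LinearIndepOn ℝ (Sum.elim v y)
        ((I.disjSum (∅ : Finset (Fin M)) : Finset (ι ⊕ Fin M)) : Set (ι ⊕ Fin M)) := by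
      rw [aux_coe_inl]
      exact LinearIndepOn.image_of_comp _ _ hI
    have h := aux_stageY n v y k hgen I (hM I hI) _ (k I) (n - I.card) 0 ∅ rfl
      (by unfold mVal; omega) (by simp; omega) (by simp) hli q (by simpa using hq)
    have e1 : pProd n v (∅ \ ∅) * q = q := by simp [pProd]
    have e2 : (Finset.univ.filter fun i : Fin M => 0 ≤ (i : ℕ)) = Finset.univ := by simp
    rw [e1]
    rw [e2] at h
    revert h
    refine aux_sup_mem LinearMap.id ?_ ?_ q
    · intro p hp
      exact Submodule.mem_sup_left hp
    · refine aux_span_mem LinearMap.id ?_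
      rintro p ⟨u, q, hu, hq, rfl⟩
      rw [aux_img_inl] at hu
      refine Submodule.mem_sup_right (Submodule.subset_span
        ⟨u, ∅, q, hu, by simp, Or.inl (by simpa using hq), ?_⟩)
      simp [pProd]
  | insert x U' hmin ih =>
    intro hup I hIU hI
    have hxU' : x ∉ U' := fun h => lt_irrefl _ (hmin x h)
    have hup' : ∀ a ∈ U', ∀ b, a < b → b ∈ U' := by
      intro a ha b hb
      have := hup a (Finset.mem_insert_of_mem ha) b hb
      rcases Finset.mem_insert.1 this with h | h
      · subst h; exact absurd (hmin a ha) (not_lt_of_gt hb)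
      · exact h
    have hxI : x ∉ I := fun h => hIU x h (by simp)
    have hIU' : ∀ i ∈ I, i ∉ U' := fun i hi h => hIU i hi (Finset.mem_insert_of_mem h)
    set S := (insert x U').disjSum (Finset.univ : Finset (Fin M)) with hSdef
    set S' := U'.disjSum (Finset.univ : Finset (Fin M)) with hS'def
    have hSS : S = insert (Sum.inl x) S' := by
      ext z; rcases z with z | z <;> simp [hSdef, hS'def]
    have hxS' : (Sum.inl x : ι ⊕ Fin M) ∉ S' := by simp [hS'def, hxU']
    have hxIJ : (Sum.inl x : ι ⊕ Fin M) ∉ I.disjSum (∅ : Finset (Fin M)) := by simp [hxI]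
    have hlt : ∀ b : ι ⊕ Fin M, Sum.Lex (· < ·) (· < ·) b (Sum.inl x) ↔ b ∉ S := by
      intro b
      rcases b with b | b
      · rw [Sum.lex_inl_inl]
        simp only [hSdef, Finset.inl_mem_disjSum]
        constructor
        · intro hb hb'
          rcases Finset.mem_insert.1 hb' with h | h
          · subst h; exact lt_irrefl _ hb
          · exact lt_asymm hb (hmin b h)
        · intro hb
          rcases lt_trichotomy b x with h | h | h
          · exact h
          · subst h; simp at hb
          · exact absurd (hup x (by simp) b h) hb
      · simp [hSdef]
    have hins : (insert x I).disjSum (∅ : Finset (Fin M)) = insert (Sum.inl x) (I.disjSum ∅) := by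
      ext z; rcases z with z | z <;> simp
    have hsd1 : ∀ Z, Z ⊆ U' → insert x U' \ Z = insert x (U' \ Z) := by
      intro Z hZ
      rw [Finset.insert_sdiff_of_notMem _ (fun h => hxU' (hZ h))]
    have hsd2 : ∀ Z, insert x U' \ insert x Z = U' \ Z := by
      intro Z
      ext z
      simp only [Finset.mem_sdiff, Finset.mem_insert]
      by_cases hz : z = x
      · subst hz; simp [hxU']
      · simp [hz]
    have hprod : ∀ Z, Z ⊆ U' → pProd n v (insert x U' \ Z) = pLin n (v x) * pProd n v (U' \ Z) := by
      intro Z hZ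
      rw [hsd1 Z hZ, pProd, Finset.prod_insert (by simp [hxU'])]
      rfl
    have hZcase : ∀ Z ⊆ insert x U', x ∈ Z → ∃ Z' ⊆ U', Z = insert x Z' := by
      intro Z hZ hx
      refine ⟨Z.erase x, ?_, (Finset.insert_erase hx).symm⟩
      intro z hz
      rw [Finset.mem_erase] at hz
      have := hZ hz.2
      simp only [Finset.mem_insert] at this
      tauto
    have hZcase0 : ∀ Z ⊆ insert x U', x ∉ Z → Z ⊆ U' := by
      intro Z hZ hx z hz
      have := hZ hz
      simp only [Finset.mem_insert] at this
      rcases this with h | h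
      · subst h; exact absurd hz hx
      · exact h
    have hmonZ : ∀ Z : Finset ι, Z ⊆ insert x Z := fun Z => Finset.subset_insert _ _
    by_cases hspan : v x ∈ Submodule.span ℝ (v '' (I : Set ι))
    · -- `x` is in the span of `I`
      have hkx : ∀ Z : Finset ι, k (insert x Z ∪ I) ≤ k (Z ∪ I) := by
        intro Z
        rw [Finset.insert_union]
        refine habs _ _ (Submodule.span_mono (Set.image_mono ?_) hspan)
        simp
      intro Z hZ q hq
      by_cases hxZ : x ∈ Z
      · obtain ⟨Z', hZ', rfl⟩ := hZcase Z hZ hxZ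
        rw [hsd2]
        have h := ih hup' I hIU' hI Z' hZ' q (hq.trans (hkx Z'))
        revert h
        refine aux_sup_mem LinearMap.id ?_ ?_ _
        · intro p hp
          exact Submodule.mem_sup_left (aux_step3 n v y k S S' _ _ hSS hlt hxIJ
            (by rw [aux_img_inl]; exact hspan) p hp)
        · refine aux_span_mem LinearMap.id ?_
          rintro p ⟨u, Z, q, hu, hZ, hq, rfl⟩
          have hk1 : k (Z ∪ I) ≤ k (insert x Z ∪ I) :=
            hmono _ _ (Finset.union_subset_union_left (hmonZ Z))
          refine Submodule.mem_sup_right (Submodule.subset_span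
            ⟨u, insert x Z, q, hu, Finset.insert_subset_insert _ hZ, ?_, ?_⟩)
          · rcases hq with hq | ⟨h1, hq⟩
            · left; omega
            · right
              refine ⟨Submodule.span_mono (Set.image_mono ?_) h1, by omega⟩
              exact Finset.coe_subset.2 (hmonZ Z)
          · rw [hsd2]; rfl
      · have hZU' := hZcase0 Z hZ hxZ
        refine Submodule.mem_sup_right (Submodule.subset_span
            ⟨v x, insert x Z, q, hspan, Finset.insert_subset_insert _ hZU', Or.inr ⟨?_, ?_⟩, ?_⟩)
        · exact Submodule.subset_span ⟨x, by simp, rfl⟩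
        · exact hq.trans (hmono _ _ (Finset.union_subset_union_left (hmonZ Z)))
        · rw [hprod Z hZU', hsd2]; ring
    · -- `x` is not in the span of `I`
      have hA : ∀ Z ⊆ U', ∀ q : MvPolynomial (Fin n) ℝ, q.totalDegree ≤ k (Z ∪ I) →
          pLin n (v x) * (pProd n v (U' \ Z) * q) ∈
            auxT n v y k S (I.disjSum ∅) ⊔ auxEX n v k (insert x U') I := by
        intro Z hZ q hq
        have h := ih hup' I hIU' hI Z hZ q hq
        revert h
        refine aux_sup_mem (LinearMap.mulLeft ℝ (pLin n (v x))) ?_ ?_ _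
        · intro p hp
          exact Submodule.mem_sup_left (aux_step2 n v y k S S' _ _ hSS hxS' hlt hxIJ
            (by rw [aux_img_inl]; exact hspan) p hp)
        · refine aux_span_mem _ ?_
          rintro p ⟨u, Z, q, hu, hZ, hq, rfl⟩
          refine Submodule.mem_sup_right (Submodule.subset_span
            ⟨u, Z, q, hu, hZ.trans (hmonZ _), hq, ?_⟩)
          rw [hprod Z hZ, LinearMap.mulLeft_apply]
          ring
      intro Z hZ q hq
      by_cases hxZ : x ∈ Z
      · obtain ⟨Z', hZ', rfl⟩ := hZcase Z hZ hxZ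
        rw [hsd2]
        have hunion : ∀ Z : Finset ι, Z ∪ insert x I = insert x Z ∪ I := by
          intro Z; ext z; simp only [Finset.mem_union, Finset.mem_insert]; tauto
        have hI' : LinearIndepOn ℝ v ((insert x I : Finset ι) : Set ι) := by
          rw [Finset.coe_insert]; exact hI.insert hspan
        have h := ih hup' (insert x I) (by
          intro i hi
          rcases Finset.mem_insert.1 hi with h | h
          · subst h; exact hxU'
          · exact hIU' i h) hI' Z' hZ' q (by rw [hunion]; exact hq)
        revert h
        refine aux_sup_mem LinearMap.id ?_ ?_ _
        · intro p hp
          rw [hins] at hp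
          exact Submodule.mem_sup_left (aux_step1 n v y k S S' _ _ hSS hxIJ p hp)
        · refine aux_span_mem LinearMap.id ?_
          rintro p ⟨u, Z, q, hu, hZ, hq, rfl⟩
          rw [hunion] at hq
          rw [Finset.coe_insert, Set.image_insert_eq, Submodule.mem_span_insert] at hu
          obtain ⟨c, u', hu', rfl⟩ := hu
          rw [LinearMap.id_apply, aux_pLin_add, aux_pLin_smul, add_mul, smul_mul_assoc]
          refine Submodule.add_mem _ ?_ ?_
          · by_cases hc : c = 0
            · rw [hc, zero_smul]; exact Submodule.zero_mem _
            refine Submodule.smul_mem _ _ (hA Z hZ q ?_)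
            rcases hq with hq | ⟨h1, hq⟩
            · have := hinc (Z ∪ I) x
              rw [Finset.insert_union] at hq
              omega
            · refine hq.trans ?_
              rw [Finset.insert_union]
              refine habs _ _ ?_
              have m1 : c • v x + u' ∈ Submodule.span ℝ (v '' ((Z ∪ I : Finset ι) : Set ι)) :=
                Submodule.span_mono (Set.image_mono (by simp)) h1
              have m2 : u' ∈ Submodule.span ℝ (v '' ((Z ∪ I : Finset ι) : Set ι)) :=
                Submodule.span_mono (Set.image_mono (by simp)) hu'
              have m3 := Submodule.sub_mem _ m1 m2
              rw [add_sub_cancel_right] at m3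
              exact (Submodule.smul_mem_iff _ hc).1 m3
          · refine Submodule.mem_sup_right (Submodule.subset_span
              ⟨u', insert x Z, q, hu', Finset.insert_subset_insert _ hZ, ?_, ?_⟩)
            · rcases hq with hq | ⟨h1, hq⟩
              · exact Or.inl hq
              · refine Or.inr ⟨?_, hq⟩
                have m1 : c • v x + u' ∈ Submodule.span ℝ (v '' ((insert x Z : Finset ι) : Set ι)) :=
                  Submodule.span_mono (Set.image_mono (by simp)) h1
                have m2 : v x ∈ Submodule.span ℝ (v '' ((insert x Z : Finset ι) : Set ι)) :=
                  Submodule.subset_span ⟨x, by simp, rfl⟩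
                have m3 := Submodule.sub_mem _ m1 (Submodule.smul_mem _ c m2)
                rwa [add_sub_cancel_left] at m3
            · rw [hsd2]
      · have hZU' := hZcase0 Z hZ hxZ
        rw [hprod Z hZU', mul_assoc]
        exact hA Z hZU' q hq

lemma aux_mem_P (B : Finset (ι ⊕ Fin M)) (hB : B ∈ Bk n v y k)
    (hsolid : Solid n v k) :
    pProd n (Sum.elim v y) (XprimeB n v y B) ∈ Pspace n v k := by
  obtain ⟨⟨hli, htop⟩, hBm⟩ := hB
  have hBd : B = (leftPart B).disjSum (rightPart B) := by
    ext z; rcases z with z | z <;> simp [leftPart, rightPart]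
  have hXd : XprimeB n v y B =
      (leftPart (XprimeB n v y B)).disjSum (rightPart (XprimeB n v y B)) := by
    ext z; rcases z with z | z <;> simp [leftPart, rightPart]
  set L := leftPart (XprimeB n v y B) with hL
  set R := rightPart (XprimeB n v y B) with hR
  set I := leftPart B with hI
  have hcard : I.card + (rightPart B).card = n := by
    rw [← Finset.card_disjSum, ← hBd]
    have h1 := finrank_span_eq_card hli
    have h2 : Set.range (fun b : B => Sum.elim v y b) = Sum.elim v y '' (B : Set (ι ⊕ Fin M)) := by
      rw [Set.image_eq_range]; rfl
    rw [h2, htop] at h1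
    simpa using h1.symm
  have hRcard : R.card ≤ k I := by
    have hdis : Disjoint R (rightPart B) := by
      rw [Finset.disjoint_left]
      intro j hj hj'
      simp only [hR, rightPart, Finset.mem_filter, Finset.mem_univ, true_and, aux_mem_Xprime] at hj hj'
      exact hj.1 hj'
    have hsub : R ∪ rightPart B ⊆ YFin (M := M) (mVal n k I) := by
      intro j hj
      simp only [YFin, Finset.mem_filter, Finset.mem_univ, true_and]
      rcases Finset.mem_union.1 hj with hj | hj
      · by_contra hlt
        simp only [hR, rightPart, Finset.mem_filter, Finset.mem_univ, true_and, aux_mem_Xprime] at hj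
        apply hj.2
        have : {b | b ∈ B ∧ Sum.Lex (· < ·) (· < ·) b (Sum.inr j)} = (B : Set (ι ⊕ Fin M)) := by
          ext b
          simp only [Set.mem_ofPred_eq, Finset.mem_coe, and_iff_left_iff_imp]
          intro hb
          rcases b with b | b
          · simp
          · rw [Sum.lex_inr_inr, Fin.lt_def]
            have := hBm b hb
            omega
        rw [this, htop]; trivial
      · simp only [rightPart, Finset.mem_filter, Finset.mem_univ, true_and] at hj
        exact hBm j hj
    have h1 := Finset.card_le_card hsub
    rw [Finset.card_union_of_disjoint hdis] at h1
    have h2 : (YFin (M := M) (mVal n k I)).card ≤ mVal n k I := by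
      have : ((YFin (M := M) (mVal n k I)).map Fin.valEmbedding) ⊆ Finset.range (mVal n k I) := by
        intro j hj
        simp only [YFin, Finset.mem_map, Finset.mem_filter, Finset.mem_univ, true_and,
          Fin.valEmbedding_apply] at hj
        obtain ⟨a, ha, rfl⟩ := hj
        simpa using ha
      have := Finset.card_le_card this
      simpa using this
    have h3 : mVal n k I = k I + n - I.card := rfl
    omega
  have hkI : k I ≤ k (Finset.univ \ L) := by
    refine hsolid _ _ (Submodule.span_mono (Set.image_mono (Finset.coe_subset.2 ?_)))
    intro i hi
    simp only [hI, hL, leftPart, Finset.mem_filter, Finset.mem_univ, true_and, Finset.mem_sdiff,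
      aux_mem_Xprime] at hi ⊢
    tauto
  have hprod : pProd n (Sum.elim v y) (XprimeB n v y B) = pProd n v L * pProd n y R := by
    rw [hXd, pProd, Finset.prod_disjSum]; rfl
  rw [hprod]
  refine Submodule.mem_iSup_of_mem (Finset.univ \ L) ?_
  refine ⟨pProd n y R, ?_, ?_⟩
  · rw [SetLike.mem_coe, MvPolynomial.mem_restrictTotalDegree]
    exact (aux_pProd_deg n y R).trans (hRcard.trans hkI)
  · simp

end steps

lemma aux_main
    (n : ℕ) (ι : Type) [Fintype ι] [LinearOrder ι]
    (v : ι → Fin n → ℝ) (M : ℕ) (y : Fin M → Fin n → ℝ)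
    (hgen : GeneralPosition n v y)
    (k : Finset ι → ℕ) (hsolid : Solid n v k)
    (hM : ∀ I : Finset ι, (LinearIndependent ℝ fun i : I => v i) → mVal n k I ≤ M)
    (hinc : Incremental k) :
    LinearIndependent ℝ (fun B : Bk n v y k =>
      pProd n (Sum.elim v y) (XprimeB n v y (B : Finset (ι ⊕ Fin M)))) ∧
    Submodule.span ℝ (Set.range fun B : Bk n v y k =>
      pProd n (Sum.elim v y) (XprimeB n v y (B : Finset (ι ⊕ Fin M)))) = Pspace n v k ∧
    Module.rank ℝ (Pspace n v k) = ((Bk n v y k).ncard : Cardinal) := by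
  have hind : LinearIndependent ℝ (fun B : Bk n v y k =>
      pProd n (Sum.elim v y) (XprimeB n v y (B : Finset (ι ⊕ Fin M)))) := by
    rw [linearIndependent_iff']
    intro s c hc
    refine @aux_indep n (ι ⊕ Fin M) (Sum.Lex.linearOrder : LinearOrder (ι ⊕ₗ Fin M))
      (Sum.elim v y) (XprimeB n v y) (aux_mem_Xprime n v y) (Bk n v y k) Subtype.val
      Subtype.val_injective (fun b => b.2.1.1) c Finset.univ (by simp) ∅ s (by simp) (by simp) ?_
    intro t _
    simp only [Finset.inter_univ]
    rw [hc]; simp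
  have hsp : Submodule.span ℝ (Set.range fun B : Bk n v y k =>
      pProd n (Sum.elim v y) (XprimeB n v y (B : Finset (ι ⊕ Fin M)))) = Pspace n v k := by
    apply le_antisymm
    · rw [Submodule.span_le]
      rintro _ ⟨B, rfl⟩
      exact aux_mem_P n v y k B B.2 hsolid
    · refine iSup_le fun Z => ?_
      rintro _ ⟨q, hq, rfl⟩
      rw [SetLike.mem_coe, MvPolynomial.mem_restrictTotalDegree] at hq
      have h := aux_stageX n v y k hgen hsolid hM hinc Finset.univ (by simp) ∅ (by simp)
        (by simp) Z (by simp) q (by simpa using hq)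
      revert h
      refine aux_sup_mem LinearMap.id ?_ ?_ _
      · refine aux_span_mem LinearMap.id ?_
        rintro p ⟨B, hB, -, rfl⟩
        refine Submodule.subset_span ⟨⟨B, hB⟩, ?_⟩
        have : (Finset.univ : Finset ι).disjSum (Finset.univ : Finset (Fin M)) = Finset.univ := by
          ext z; rcases z with z | z <;> simp
        simp [this]
      · refine aux_span_mem LinearMap.id ?_
        rintro p ⟨u, Z, q, hu, -, -, rfl⟩
        have hu0 : u = 0 := by simpa using hu
        rw [hu0, aux_pLin_zero]
        simp
  refine ⟨hind, hsp, ?_⟩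
  rw [← hsp, rank_span hind, Cardinal.mk_range_eq _ hind.injective]
  have : Finite (Bk n v y k) := inferInstance
  rw [← Nat.card_coe_set_eq, Nat.cast_card]

end helpers

/-- for a solid and incremental assignment, the homogeneous polynomials
`p_{X'(B)}`, `B ∈ 𝔹_k`, form a basis of `𝒫_k`; in particular `dim 𝒫_k = #𝔹_k`. -/
theorem statement12
    (n : ℕ) (hn : 1 ≤ n) (ι : Type) [Fintype ι] [DecidableEq ι]
    (v : ι → Fin n → ℝ) (M : ℕ) (y : Fin M → Fin n → ℝ)
    (hspan : Submodule.span ℝ (Set.range (Sum.elim v y)) = ⊤)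
    (hgen : GeneralPosition n v y)
    (k : Finset ι → ℕ) (hsolid : Solid n v k)
    (hM : ∀ I : Finset ι, (LinearIndependent ℝ fun i : I => v i) → mVal n k I ≤ M)
    (hinc : Incremental k) [LinearOrder ι] :
    LinearIndependent ℝ (fun B : Bk n v y k =>
      pProd n (Sum.elim v y) (XprimeB n v y (B : Finset (ι ⊕ Fin M)))) ∧
    Submodule.span ℝ (Set.range fun B : Bk n v y k =>
      pProd n (Sum.elim v y) (XprimeB n v y (B : Finset (ι ⊕ Fin M)))) = Pspace n v k ∧
    Module.rank ℝ (Pspace n v k) = ((Bk n v y k).ncard : Cardinal) := by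

  have hdec : ‹DecidableEq ι› = (LinearOrder.toDecidableEq : DecidableEq ι) :=
    Subsingleton.elim _ _
  subst hdec
  exact aux_main n ι v M y hgen k hsolid hM hinc
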